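/- Let C ⊆ {0,1}^r be a binary code with minimum Hamming distance at least r/2, let T ∈ R^{d×d} be the cyclic shift, and for c ∈ C let D_c ∈ R^{d×r} have D_c(i,i) = (-1)^{c_i} for i ≤ r and zeros elsewhere. Then each T^a D_c lies in St_R(d,r), and for (a,c) ≠ (a',c'), Tr((T^a D_c)ᵀ (T^{a'} D_{c'})) = δ_{a,a'}(r - 2·dist(c,c')) ≤ 0. -/

import Mathlib

open Matrix

/-- Real cyclic shift matrix: `T eₖ = e_{k+1 mod d}`. -/
def shiftT (d : ℕ) : Matrix (Fin d) (Fin d) ℝ :=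
  Matrix.of fun i j => if (i : ℕ) = ((j : ℕ) + 1) % d then 1 else 0

/-- The sign matrix `D_c ∈ ℝ^{d×r}` of a binary word `c`:
`D_c(i,i) = (-1)^{c_i}` and zeros elsewhere. -/
def signD (d r : ℕ) (c : Fin r → Bool) : Matrix (Fin d) (Fin r) ℝ :=
  Matrix.of fun i j =>
    if (i : ℕ) = (j : ℕ) then (if c j then -1 else 1) else 0

/-- Powers of the cyclic shift: `Tᵃ eⱼ = e_{j+a mod d}`. -/
lemma shiftT_pow_apply (d a : ℕ) (i j : Fin d) :
    (shiftT d ^ a) i j = if (i : ℕ) = ((j : ℕ) + a) % d then 1 else 0 := by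
  induction a generalizing i j with
  | zero => simp [Matrix.one_apply, Fin.ext_iff, Nat.mod_eq_of_lt j.isLt]
  | succ a ih =>
    have hd : 0 < d := i.pos
    rw [pow_succ, Matrix.mul_apply,
      Finset.sum_eq_single (⟨((j : ℕ) + 1) % d, Nat.mod_lt _ hd⟩ : Fin d)]
    · rw [ih]
      simp [shiftT, Nat.add_assoc, Nat.add_comm 1 a]
    · intro k _ hk
      have hk' : (k : ℕ) ≠ ((j : ℕ) + 1) % d := fun h => hk (Fin.ext h)
      simp [shiftT, hk']
    · simp

lemma shiftT_pow_mul_signD_apply {d r : ℕ} (hdr : r ≤ d) (a : ℕ) (c : Fin r → Bool)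
    (i : Fin d) (j : Fin r) :
    (shiftT d ^ a * signD d r c) i j =
      if (i : ℕ) = ((j : ℕ) + a) % d then (if c j then -1 else 1) else 0 := by
  rw [Matrix.mul_apply, Finset.sum_eq_single (Fin.castLE hdr j)]
  · simp only [shiftT_pow_apply, signD, Matrix.of_apply, Fin.val_castLE, if_true]
    split_ifs <;> simp
  · intro k _ hk
    have hk' : (k : ℕ) ≠ (j : ℕ) := fun h => hk (Fin.ext h)
    simp [signD, hk']
  · simp

lemma transpose_mul_shiftT_pow_mul_signD_apply {d r : ℕ} (hdr : r ≤ d) (a a' : ℕ)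
    (c c' : Fin r → Bool) (j k : Fin r) :
    ((shiftT d ^ a * signD d r c)ᵀ * (shiftT d ^ a' * signD d r c')) j k =
      if ((j : ℕ) + a) % d = ((k : ℕ) + a') % d then
        (if c j then -1 else 1) * (if c' k then -1 else 1) else 0 := by
  have hd : 0 < d := j.pos.trans_le hdr
  rw [Matrix.mul_apply,
    Finset.sum_eq_single (⟨((j : ℕ) + a) % d, Nat.mod_lt _ hd⟩ : Fin d)]
  · simp [shiftT_pow_mul_signD_apply hdr]
  · intro i _ hi
    have hi' : (i : ℕ) ≠ ((j : ℕ) + a) % d := fun h => hi (Fin.ext h)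
    simp [shiftT_pow_mul_signD_apply hdr, hi']
  · simp

/-- The inner product of two sign vectors in terms of the Hamming distance. -/
lemma sum_sign_mul_sign {r : ℕ} (c c' : Fin r → Bool) :
    ∑ j, (if c j then (-1 : ℝ) else 1) * (if c' j then -1 else 1) =
      r - 2 * hammingDist c c' := by
  have h (j : Fin r) : (if c j then (-1 : ℝ) else 1) * (if c' j then -1 else 1) =
      1 - 2 * (if c j ≠ c' j then 1 else 0) := by
    cases c j <;> cases c' j <;> norm_num
  simp_rw [h, Finset.sum_sub_distrib, ← Finset.mul_sum, Finset.sum_boole]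
  simp [hammingDist]

lemma transpose_mul_self_shiftT_pow_mul_signD {d r : ℕ} (hdr : r ≤ d) (a : ℕ)
    (c : Fin r → Bool) :
    (shiftT d ^ a * signD d r c)ᵀ * (shiftT d ^ a * signD d r c) = 1 := by
  ext j k
  rw [transpose_mul_shiftT_pow_mul_signD_apply hdr, Matrix.one_apply]
  have hjk : ((j : ℕ) + a) % d = ((k : ℕ) + a) % d ↔ j = k :=
    ⟨fun h => Fin.ext ((Nat.ModEq.add_right_cancel' a h).eq_of_lt_of_lt
      (j.isLt.trans_le hdr) (k.isLt.trans_le hdr)), fun h => by rw [h]⟩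
  simp only [hjk]
  split_ifs <;> simp_all

lemma trace_transpose_mul_shiftT_pow_mul_signD {d r : ℕ} (hdr : r ≤ d) (a a' : Fin d)
    (c c' : Fin r → Bool) :
    Matrix.trace ((shiftT d ^ (a : ℕ) * signD d r c)ᵀ *
        (shiftT d ^ (a' : ℕ) * signD d r c')) =
      if a = a' then (r : ℝ) - 2 * hammingDist c c' else 0 := by
  have haa' (j : ℕ) : (j + (a : ℕ)) % d = (j + (a' : ℕ)) % d ↔ a = a' :=
    ⟨fun h => Fin.ext ((Nat.ModEq.add_left_cancel' j h).eq_of_lt_of_lt a.isLt a'.isLt),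
      fun h => by rw [h]⟩
  simp only [Matrix.trace, Matrix.diag_apply, transpose_mul_shiftT_pow_mul_signD_apply hdr,
    haa']
  split_ifs with h
  · exact sum_sign_mul_sign c c'
  · simp

theorem real_stiefel_orthoplex_from_binary_code (d r : ℕ) (hdr : r ≤ d)
    (C : Finset (Fin r → Bool))
    (hC : ∀ c ∈ C, ∀ c' ∈ C, c ≠ c' → r ≤ 2 * hammingDist c c') :
    (∀ (a : Fin d), ∀ c ∈ C, (shiftT d ^ (a : ℕ) * signD d r c)ᵀ *
        (shiftT d ^ (a : ℕ) * signD d r c) = 1) ∧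
    (∀ (a a' : Fin d), ∀ c ∈ C, ∀ c' ∈ C, (a, c) ≠ (a', c') →
      Matrix.trace ((shiftT d ^ (a : ℕ) * signD d r c)ᵀ *
          (shiftT d ^ (a' : ℕ) * signD d r c')) =
        (if a = a' then (r : ℝ) - 2 * hammingDist c c' else 0) ∧
      Matrix.trace ((shiftT d ^ (a : ℕ) * signD d r c)ᵀ *
          (shiftT d ^ (a' : ℕ) * signD d r c')) ≤ 0) := by
  refine ⟨fun a c _ => transpose_mul_self_shiftT_pow_mul_signD hdr a c,
    fun a a' c hc c' hc' hne => ?_⟩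
  rw [trace_transpose_mul_shiftT_pow_mul_signD hdr]
  refine ⟨rfl, ?_⟩
  split_ifs with h
  · have hcc : c ≠ c' := fun hcc => hne (by rw [h, hcc])
    have hdist : (r : ℝ) ≤ 2 * hammingDist c c' := by exact_mod_cast hC c hc c' hc' hcc
    linarith
  · exact le_rfl
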